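/- Let A, B, C, D be finite types, let f be a fixed-point-free involution of A ⊕ B, let g be a fixed-point-free involution of B ⊕ C, and let h be a fixed-point-free involution of C ⊕ D. Then composition of matchings is associative: (f * g) * h = f * (g * h) as fixed-point-free involutions of A ⊕ D. -/

import Mathlib

open Sum

variable {A B C : Type*}

/-- The natural embedding of `A ⊕ B` into `A ⊕ B ⊕ C`. -/
def embAB : A ⊕ B → A ⊕ B ⊕ C
  | inl a => inl a
  | inr b => inr (inl b)

/-- The natural embedding of `B ⊕ C` into `A ⊕ B ⊕ C`. -/
def embBC : B ⊕ C → A ⊕ B ⊕ C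
  | inl b => inr (inl b)
  | inr c => inr (inr c)

/-- The natural embedding of `A ⊕ C` into `A ⊕ B ⊕ C`. -/
def embAC : A ⊕ C → A ⊕ B ⊕ C
  | inl a => inl a
  | inr c => inr (inr c)

/-- The simple graph on `A ⊕ B ⊕ C` whose edges join (the images of) `x` and `f x`
for each `x : A ⊕ B`, and (the images of) `y` and `g y` for each `y : B ⊕ C`. -/
def matchGraph (f : A ⊕ B → A ⊕ B) (g : B ⊕ C → B ⊕ C) :
    SimpleGraph (A ⊕ B ⊕ C) :=
  SimpleGraph.fromRel fun u v =>
    (∃ x : A ⊕ B, u = embAB x ∧ v = embAB (f x)) ∨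
    (∃ y : B ⊕ C, u = embBC y ∧ v = embBC (g y))

/-- `m` is the composite matching `f * g`: the (unique) fixed-point-free involution of
`A ⊕ C` such that `x` and `m x` always lie in the same connected component of `G`. -/
def IsComposite (f : A ⊕ B → A ⊕ B) (g : B ⊕ C → B ⊕ C)
    (m : A ⊕ C → A ⊕ C) : Prop :=
  m ∘ m = id ∧ (∀ x, m x ≠ x) ∧
    ∀ x : A ⊕ C, (matchGraph f g).Reachable (embAC x) (embAC (m x))

theorem aux_two_ends {W : Type*} (P Q : Equiv.Perm W) (hP : ∀ w, P (P w) = w)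
    (hP' : ∀ w, P w ≠ w) (hQ : ∀ w, Q (Q w) = w) (x y z : W)
    (hx : Q x = x) (hy : Q y = y) (hz : Q z = z) (hyx : y ≠ x) (hzx : z ≠ x)
    (hxy : ∀ Z : W → Prop, (∀ w, Z w → Z (P w)) → (∀ w, Z w → Z (Q w)) → Z x → Z y)
    (hxz : ∀ Z : W → Prop, (∀ w, Z w → Z (P w)) → (∀ w, Z w → Z (Q w)) → Z x → Z z) :
    y = z := by
  have hPP : P * P = 1 := Equiv.ext hP
  have hQQ : Q * Q = 1 := Equiv.ext hQ
  have hPi : P⁻¹ = P := inv_eq_of_mul_eq_one_left hPP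
  have hQi : Q⁻¹ = Q := inv_eq_of_mul_eq_one_left hQQ
  obtain ⟨T, hT⟩ : ∃ T, T = P * Q := ⟨_, rfl⟩
  have hconj : Q * T * Q⁻¹ = T⁻¹ := by
    rw [hT, mul_inv_rev, hPi, hQi, mul_assoc, mul_assoc, hQQ, mul_one]
  have hQn : ∀ n : ℤ, Q ((T ^ n) x) = (T ^ (-n)) x := by
    intro n
    have h1 : Q * T ^ n * Q⁻¹ = T ^ (-n) := by
      rw [← conj_zpow, hconj, inv_zpow, zpow_neg]
    have h2 := congrArg (fun e : Equiv.Perm W => e x) h1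
    simpa [hQi, hx] using h2
  have hPn : ∀ n : ℤ, P ((T ^ n) x) = (T ^ (1 - n)) x := by
    intro n
    have h1 : P = T * Q := by rw [hT, mul_assoc, hQQ, mul_one]
    rw [sub_eq_add_neg, zpow_add, zpow_one, Equiv.Perm.mul_apply, ← hQn]
    conv_lhs => rw [h1]
    rfl
  have key : ∀ n : ℤ, (T ^ n) x = x ↔ (MulAction.period T x : ℤ) ∣ n := fun n =>
    MulAction.zpow_smul_eq_iff_period_dvd (g := T) (a := x)
  have key2 : ∀ n m : ℤ, (T ^ n) x = (T ^ m) x ↔ (MulAction.period T x : ℤ) ∣ n - m := by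
    intro n m
    rw [← key, sub_eq_neg_add, zpow_add, zpow_neg, Equiv.Perm.mul_apply, Equiv.Perm.inv_eq_iff_eq]
  have orb : ∀ y, (∀ Z : W → Prop, (∀ w, Z w → Z (P w)) → (∀ w, Z w → Z (Q w)) → Z x → Z y) →
      ∃ n : ℤ, y = (T ^ n) x := by
    intro y hy
    refine hy (fun w => ∃ n : ℤ, w = (T ^ n) x) ?_ ?_ ⟨0, by simp⟩
    · rintro _ ⟨n, rfl⟩
      exact ⟨1 - n, hPn n⟩
    · rintro _ ⟨n, rfl⟩
      exact ⟨-n, hQn n⟩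
  obtain ⟨n, rfl⟩ := orb y hxy
  obtain ⟨m, rfl⟩ := orb z hxz
  rw [hQn, key2] at hy hz
  rw [Ne, key] at hyx hzx
  rw [key2]
  have hodd : ∀ n : ℤ, ¬ (MulAction.period T x : ℤ) ∣ (1 - n) - n := by
    intro n hn
    rw [← key2, ← hPn] at hn
    exact hP' _ hn
  generalize (MulAction.period T x : ℤ) = p at *
  rcases Int.even_or_odd' p with ⟨k, rfl | rfl⟩
  · obtain ⟨a, ha⟩ := hy
    obtain ⟨b, hb⟩ := hz
    have ha' : n = -(k * a) := by linarith
    have hb' : m = -(k * b) := by linarith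
    rcases Int.even_or_odd' a with ⟨c, rfl | rfl⟩
    · exact absurd ⟨-c, by rw [ha']; ring⟩ hyx
    rcases Int.even_or_odd' b with ⟨d, rfl | rfl⟩
    · exact absurd ⟨-d, by rw [hb']; ring⟩ hzx
    exact ⟨d - c, by rw [ha', hb']; ring⟩
  · exact absurd ⟨1, by ring⟩ (hodd (-k))

theorem aux_reach {A B C W : Type*} (f : A ⊕ B → A ⊕ B) (g : B ⊕ C → B ⊕ C)
    (φ : A ⊕ B ⊕ C → W) (Z : W → Prop)
    (h1 : ∀ x, Z (φ (embAB x)) ↔ Z (φ (embAB (f x))))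
    (h2 : ∀ x, Z (φ (embBC x)) ↔ Z (φ (embBC (g x)))) (u v : A ⊕ B ⊕ C)
    (h : (matchGraph f g).Reachable u v) : Z (φ u) ↔ Z (φ v) := by
  obtain ⟨p⟩ := h
  induction p with
  | nil => rfl
  | cons hadj _ ih =>
    rw [← ih]
    rw [matchGraph, SimpleGraph.fromRel_adj] at hadj
    obtain ⟨_, (⟨x, rfl, rfl⟩ | ⟨x, rfl, rfl⟩) | (⟨x, rfl, rfl⟩ | ⟨x, rfl, rfl⟩)⟩ := hadj
    · exact h1 x
    · exact h2 x
    · exact (h1 x).symm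
    · exact (h2 x).symm

def auxK {A B C D : Type*} : B ⊕ C → (A ⊕ B) ⊕ (C ⊕ D)
  | inl b => inl (inr b)
  | inr c => inr (inl c)

def auxQ {A B C D : Type*} (g : B ⊕ C → B ⊕ C) : (A ⊕ B) ⊕ (C ⊕ D) → (A ⊕ B) ⊕ (C ⊕ D)
  | inl (inl a) => inl (inl a)
  | inl (inr b) => auxK (g (inl b))
  | inr (inl c) => auxK (g (inr c))
  | inr (inr d) => inr (inr d)

theorem auxQ_K {A B C D : Type*} (g : B ⊕ C → B ⊕ C) (y : B ⊕ C) :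
    auxQ g (auxK y : (A ⊕ B) ⊕ (C ⊕ D)) = auxK (g y) := by
  cases y <;> rfl

def auxE {A B C D : Type*} : A ⊕ D → (A ⊕ B) ⊕ (C ⊕ D)
  | inl a => inl (inl a)
  | inr d => inr (inr d)

def auxF1 {A B C D : Type*} : A ⊕ B ⊕ C → (A ⊕ B) ⊕ (C ⊕ D)
  | inl a => inl (inl a)
  | inr (inl b) => inl (inr b)
  | inr (inr c) => inr (inl c)

def auxF2 {A B C D : Type*} : B ⊕ C ⊕ D → (A ⊕ B) ⊕ (C ⊕ D)
  | inl b => inl (inr b)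
  | inr (inl c) => inr (inl c)
  | inr (inr d) => inr (inr d)

def auxF3 {A B C D : Type*} : A ⊕ C ⊕ D → (A ⊕ B) ⊕ (C ⊕ D)
  | inl a => inl (inl a)
  | inr x => inr x

def auxF4 {A B C D : Type*} : A ⊕ B ⊕ D → (A ⊕ B) ⊕ (C ⊕ D)
  | inl a => inl (inl a)
  | inr (inl b) => inl (inr b)
  | inr (inr d) => inr (inr d)

/-- Composition of matchings is associative: `(f * g) * h = f * (g * h)` as
fixed-point-free involutions of `A ⊕ D`. -/
theorem stmt10 {D : Type*} [Fintype A] [Fintype B] [Fintype C] [Fintype D]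
    (f : A ⊕ B → A ⊕ B) (hf : f ∘ f = id) (hf' : ∀ x, f x ≠ x)
    (g : B ⊕ C → B ⊕ C) (hg : g ∘ g = id) (hg' : ∀ y, g y ≠ y)
    (h : C ⊕ D → C ⊕ D) (hh : h ∘ h = id) (hh' : ∀ z, h z ≠ z)
    (mfg : A ⊕ C → A ⊕ C) (hmfg : IsComposite f g mfg)
    (mgh : B ⊕ D → B ⊕ D) (hmgh : IsComposite g h mgh)
    (m₁ : A ⊕ D → A ⊕ D) (hm₁ : IsComposite mfg h m₁)
    (m₂ : A ⊕ D → A ⊕ D) (hm₂ : IsComposite f mgh m₂) :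
    m₁ = m₂ := by
  have hf2 : ∀ x, f (f x) = x := congrFun hf
  have hg2 : ∀ x, g (g x) = x := congrFun hg
  have hh2 : ∀ x, h (h x) = x := congrFun hh
  have hP : ∀ w, Sum.map f h (Sum.map f h w) = w := by
    rintro (w | w) <;> simp [hf2, hh2]
  have hP' : ∀ w, Sum.map f h w ≠ w := by
    rintro (w | w) <;> simp [hf', hh']
  have hQ : ∀ w : (A ⊕ B) ⊕ (C ⊕ D), auxQ g (auxQ g w) = w := by
    rintro ((a | b) | (c | d))
    · rfl
    · change auxQ g (auxK (g (inl b))) = _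
      rw [auxQ_K, hg2]; rfl
    · change auxQ g (auxK (g (inr c))) = _
      rw [auxQ_K, hg2]; rfl
    · rfl
  have hE : ∀ x : A ⊕ D, auxQ g (auxE x : (A ⊕ B) ⊕ (C ⊕ D)) = auxE x := by
    rintro (a | d) <;> rfl
  have hEi : Function.Injective (auxE : A ⊕ D → (A ⊕ B) ⊕ (C ⊕ D)) := by
    rintro (a | d) (a' | d') <;> simp [auxE]
  have main : ∀ Z : (A ⊕ B) ⊕ (C ⊕ D) → Prop, (∀ w, Z w → Z (Sum.map f h w)) →
      (∀ w, Z w → Z (auxQ g w)) → ∀ x : A ⊕ D,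
      (Z (auxE x) ↔ Z (auxE (m₁ x))) ∧ (Z (auxE x) ↔ Z (auxE (m₂ x))) := by
    intro Z hZP hZQ x
    have zf : ∀ x, Z (inl x) ↔ Z (inl (f x)) := fun x =>
      ⟨hZP (inl x), fun hz => by simpa [hf2] using hZP _ hz⟩
    have zh : ∀ x, Z (inr x) ↔ Z (inr (h x)) := fun x =>
      ⟨hZP (inr x), fun hz => by simpa [hh2] using hZP _ hz⟩
    have zg : ∀ x, Z (auxK x) ↔ Z (auxK (g x)) := fun x =>
      ⟨fun hz => by simpa [auxQ_K] using hZQ _ hz,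
        fun hz => by simpa [auxQ_K, hg2] using hZQ _ hz⟩
    have e1 : ∀ x : A ⊕ B, (auxF1 (embAB x) : (A ⊕ B) ⊕ (C ⊕ D)) = inl x := by
      rintro (_ | _) <;> rfl
    have e2 : ∀ x : B ⊕ C, (auxF1 (embBC x) : (A ⊕ B) ⊕ (C ⊕ D)) = auxK x := by
      rintro (_ | _) <;> rfl
    have e3 : ∀ x : B ⊕ C, (auxF2 (embAB x) : (A ⊕ B) ⊕ (C ⊕ D)) = auxK x := by
      rintro (_ | _) <;> rfl
    have e4 : ∀ x : C ⊕ D, (auxF2 (embBC x) : (A ⊕ B) ⊕ (C ⊕ D)) = inr x := by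
      rintro (_ | _) <;> rfl
    have e5 : ∀ x : A ⊕ C, (auxF3 (embAB x) : (A ⊕ B) ⊕ (C ⊕ D)) = auxF1 (embAC x) := by
      rintro (_ | _) <;> rfl
    have e6 : ∀ x : C ⊕ D, (auxF3 (embBC x) : (A ⊕ B) ⊕ (C ⊕ D)) = inr x := by
      rintro (_ | _) <;> rfl
    have e7 : ∀ x : A ⊕ D, (auxF3 (embAC x) : (A ⊕ B) ⊕ (C ⊕ D)) = auxE x := by
      rintro (_ | _) <;> rfl
    have e8 : ∀ x : A ⊕ B, (auxF4 (embAB x) : (A ⊕ B) ⊕ (C ⊕ D)) = inl x := by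
      rintro (_ | _) <;> rfl
    have e9 : ∀ x : B ⊕ D, (auxF4 (embBC x) : (A ⊕ B) ⊕ (C ⊕ D)) = auxF2 (embAC x) := by
      rintro (_ | _) <;> rfl
    have e10 : ∀ x : A ⊕ D, (auxF4 (embAC x) : (A ⊕ B) ⊕ (C ⊕ D)) = auxE x := by
      rintro (_ | _) <;> rfl
    have r1 := fun x => aux_reach f g auxF1 Z (fun x => by rw [e1, e1]; exact zf x)
      (fun x => by rw [e2, e2]; exact zg x) _ _ (hmfg.2.2 x)
    have r2 := fun x => aux_reach g h auxF2 Z (fun x => by rw [e3, e3]; exact zg x)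
      (fun x => by rw [e4, e4]; exact zh x) _ _ (hmgh.2.2 x)
    have r3 := aux_reach mfg h auxF3 Z (fun x => by rw [e5, e5]; exact r1 x)
      (fun x => by rw [e6, e6]; exact zh x) _ _ (hm₁.2.2 x)
    have r4 := aux_reach f mgh auxF4 Z (fun x => by rw [e8, e8]; exact zf x)
      (fun x => by rw [e9, e9]; exact r2 x) _ _ (hm₂.2.2 x)
    rw [e7, e7] at r3
    rw [e10, e10] at r4
    exact ⟨r3, r4⟩
  funext x
  apply hEi
  exact aux_two_ends ⟨Sum.map f h, Sum.map f h, hP, hP⟩ ⟨auxQ g, auxQ g, hQ, hQ⟩ hP hP' hQ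
    (auxE x) _ _ (hE _) (hE _) (hE _) (hEi.ne (hm₁.2.1 x)) (hEi.ne (hm₂.2.1 x))
    (fun Z h1 h2 => (main Z h1 h2 x).1.1) (fun Z h1 h2 => (main Z h1 h2 x).2.1)
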